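/- arXiv:1912.09656 — 3 statements merged into one kernel-verified Lean document; each statement's English description precedes it below -/
import Mathlib

section
/- Let λ_1, …, λ_P be strictly positive real numbers and let κ ≥ 1 be such that λ_i ≤ κ λ_j for all i, j (i.e. κ bounds the condition number max_i λ_i / min_j λ_j). Then (Σ_{i=1}^P λ_i²) / (Σ_{i=1}^P λ_i)² ≤ 1 / (1 + (P−1)/κ²). In particular, when κ is bounded independently of P, this ratio — which controls the squared signal-to-noise ratio of the Hutchinson trace estimator uᵀHu for a positive definite matrix H with eigenvalues λ_i — tends to 0 as P → ∞. -/
open Finset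

/-- If every entry is at most `κ` times every other one, then each entry `lam i` satisfies
`lam i * (1 + (P - 1) / κ ^ 2) ≤ ∑ j, lam j`. -/
theorem mul_one_add_div_sq_le_sum {P : ℕ} (lam : Fin P → ℝ) (hpos : ∀ i, 0 < lam i)
    {κ : ℝ} (hκ : 1 ≤ κ) (hcond : ∀ i j, lam i ≤ κ * lam j) (i : Fin P) :
    lam i * (1 + ((P : ℝ) - 1) / κ ^ 2) ≤ ∑ j, lam j := by
  have hterm : ∀ j ∈ univ.erase i, lam i / κ ^ 2 ≤ lam j := fun j _ => by
    rw [div_le_iff₀ (by positivity)]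
    nlinarith [hcond i j, mul_le_mul_of_nonneg_left (le_self_pow₀ hκ two_ne_zero) (hpos j).le]
  have hsum := card_nsmul_le_sum _ _ _ hterm
  have hP : 1 ≤ P := i.pos
  rw [card_erase_of_mem (mem_univ i), card_univ, Fintype.card_fin, nsmul_eq_mul,
    Nat.cast_sub hP, Nat.cast_one] at hsum
  rw [← add_sum_erase univ lam (mem_univ i)]
  calc lam i * (1 + ((P : ℝ) - 1) / κ ^ 2) = lam i + ((P : ℝ) - 1) * (lam i / κ ^ 2) := by ring
    _ ≤ _ := by gcongr

/-- If `λ_1, …, λ_P > 0` and `κ ≥ 1` bounds the condition number, i.e.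
`λ_i ≤ κ λ_j` for all `i, j`, then
`(Σ λ_i²)/(Σ λ_i)² ≤ 1/(1 + (P−1)/κ²)`. This ratio controls the squared
signal-to-noise ratio of the Hutchinson trace estimator for a positive definite
matrix with eigenvalues `λ_i`. -/
theorem trace_sq_ratio_le_of_condition_number
    {P : ℕ} (hP : 0 < P) (lam : Fin P → ℝ) (hpos : ∀ i, 0 < lam i)
    (κ : ℝ) (hκ : 1 ≤ κ) (hcond : ∀ i j, lam i ≤ κ * lam j) :
    (∑ i : Fin P, (lam i) ^ 2) / (∑ i : Fin P, lam i) ^ 2 ≤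
      1 / (1 + ((P : ℝ) - 1) / κ ^ 2) := by
  have hP1 : (0 : ℝ) ≤ (P : ℝ) - 1 := sub_nonneg.2 (by exact_mod_cast hP)
  have hS : 0 < ∑ i, lam i := sum_pos (fun i _ => hpos i) ⟨⟨0, hP⟩, mem_univ _⟩
  rw [div_le_div_iff₀ (by positivity) (by positivity), one_mul, sum_mul, sq (∑ i, lam i), sum_mul]
  refine sum_le_sum fun i _ => ?_
  rw [sq, mul_assoc]
  exact mul_le_mul_of_nonneg_left (mul_one_add_div_sq_le_sum lam hpos hκ hcond i) (hpos i).le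
end

section
/- Let H be a real symmetric P×P matrix, let v_1 be a unit vector, and suppose the Lanczos recurrence applied to H with seed v_1 runs for m steps with β_2, …, β_m all nonzero, producing the tridiagonal matrix T_m. Then the Lanczos approximation matches the first m moments of the seed vector against H: for every integer 0 ≤ k ≤ m, v_1ᵀ H^k v_1 = e_1ᵀ (T_m)^k e_1, where e_1 is the first standard basis vector of ℝ^m. Combined with the spectral decomposition of T_m, this says that the discrete measure Σ_i τ_i² δ_{θ_i} built from the Ritz values θ_i and squared first eigenvector components τ_i² of T_m has the same moments v_1ᵀH^k v_1 for 1 ≤ k ≤ m. -/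
open Matrix

/-- The Lanczos recurrence applied to `H` with seed `v 1` (a unit vector), run for `m`
steps: `v 0 = 0`, `β 1 = 0`, and for `1 ≤ j`: `α j = ⟨v j, H (v j)⟩`,
`r j = H (v j) − α j • v j − β j • v (j−1)`, `β (j+1) = ‖r j‖`,
`v (j+1) = r j / β (j+1)`, with `β 2, …, β m` all nonzero. -/
structure IsLanczos {P : ℕ} (H : Matrix (Fin P) (Fin P) ℝ) (m : ℕ)
    (α β : ℕ → ℝ) (v : ℕ → (Fin P → ℝ)) : Prop where
  v_zero : v 0 = 0
  beta_one : β 1 = 0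
  seed_unit : v 1 ⬝ᵥ v 1 = 1
  alpha_def : ∀ j, 1 ≤ j → j ≤ m → α j = v j ⬝ᵥ H.mulVec (v j)
  beta_def : ∀ j, 1 ≤ j → j < m →
    β (j + 1) = Real.sqrt ((H.mulVec (v j) - α j • v j - β j • v (j - 1)) ⬝ᵥ
      (H.mulVec (v j) - α j • v j - β j • v (j - 1)))
  beta_ne : ∀ j, 2 ≤ j → j ≤ m → β j ≠ 0
  v_succ : ∀ j, 1 ≤ j → j < m →
    v (j + 1) = (β (j + 1))⁻¹ • (H.mulVec (v j) - α j • v j - β j • v (j - 1))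


/-- The Lanczos tridiagonal matrix `T_m`: diagonal entries `α 1, …, α m` and
sub/super-diagonal entries `β 2, …, β m` (indices of `Fin m` are zero-based). -/
def lanczosTridiag (m : ℕ) (α β : ℕ → ℝ) : Matrix (Fin m) (Fin m) ℝ :=
  Matrix.of fun i j =>
    if (i : ℕ) = (j : ℕ) then α ((i : ℕ) + 1)
    else if (i : ℕ) + 1 = (j : ℕ) then β ((j : ℕ) + 1)
    else if (j : ℕ) + 1 = (i : ℕ) then β ((i : ℕ) + 1)
    else 0

/-- The unnormalized Lanczos residual `H v_j − α_j v_j − β_j v_{j−1}`. -/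
def lanczosResidual {P : ℕ} (H : Matrix (Fin P) (Fin P) ℝ) (α β : ℕ → ℝ)
    (v : ℕ → (Fin P → ℝ)) (j : ℕ) : Fin P → ℝ :=
  H.mulVec (v j) - α j • v j - β j • v (j - 1)

theorem mulVec_eq_add_lanczosResidual {P : ℕ} (H : Matrix (Fin P) (Fin P) ℝ) (α β : ℕ → ℝ)
    (v : ℕ → (Fin P → ℝ)) (j : ℕ) :
    H.mulVec (v j) = α j • v j + β j • v (j - 1) + lanczosResidual H α β v j := by
  unfold lanczosResidual
  abel

theorem Matrix.IsSymm.dotProduct_mulVec_comm {P : ℕ} {H : Matrix (Fin P) (Fin P) ℝ}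
    (hH : H.IsSymm) (x y : Fin P → ℝ) : x ⬝ᵥ H.mulVec y = y ⬝ᵥ H.mulVec x := by
  rw [dotProduct_mulVec, ← mulVec_transpose, hH.eq, dotProduct_comm]

namespace IsLanczos

variable {P : ℕ} {H : Matrix (Fin P) (Fin P) ℝ} {m : ℕ} {α β : ℕ → ℝ} {v : ℕ → (Fin P → ℝ)}

theorem lanczosResidual_eq (hL : IsLanczos H m α β v) {j : ℕ} (hj : 1 ≤ j) (hjm : j < m) :
    lanczosResidual H α β v j = β (j + 1) • v (j + 1) := by
  rw [hL.v_succ j hj hjm, smul_inv_smul₀ (hL.beta_ne (j + 1) (by omega) (by omega))]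
  rfl

theorem dotProduct_self_succ (hL : IsLanczos H m α β v) {j : ℕ} (hj : 1 ≤ j) (hjm : j < m) :
    v (j + 1) ⬝ᵥ v (j + 1) = 1 := by
  have hne := hL.beta_ne (j + 1) (by omega) (by omega)
  have hsq : β (j + 1) * β (j + 1) =
      lanczosResidual H α β v j ⬝ᵥ lanczosResidual H α β v j := by
    rw [hL.beta_def j hj hjm]
    exact Real.mul_self_sqrt (Finset.sum_nonneg fun i _ => mul_self_nonneg _)
  rw [hL.lanczosResidual_eq hj hjm, smul_dotProduct, dotProduct_smul, smul_eq_mul,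
    smul_eq_mul, ← mul_assoc] at hsq
  exact mul_left_cancel₀ (mul_ne_zero hne hne) (by rw [mul_one]; exact hsq.symm)

/-- If the Lanczos vectors `v_1, …, v_n` are orthonormal, then they are orthogonal to the
residual of step `n`. -/
theorem dotProduct_lanczosResidual (hL : IsLanczos H m α β v) (hH : H.IsSymm) {n : ℕ}
    (hnm : n ≤ m)
    (ho : ∀ i j, 1 ≤ i → i ≤ n → 1 ≤ j → j ≤ n → v i ⬝ᵥ v j = if i = j then 1 else 0)
    {i : ℕ} (hi : 1 ≤ i) (hin : i ≤ n) : v i ⬝ᵥ lanczosResidual H α β v n = 0 := by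
  have hpred : ∀ j k, j < k → 1 ≤ k → k ≤ n → v j ⬝ᵥ v k = 0 := by
    intro j k hjk hk hkn
    rcases Nat.eq_zero_or_pos j with rfl | hj
    · rw [hL.v_zero, zero_dotProduct]
    · rw [ho j k hj (by omega) hk hkn, if_neg (by omega)]
  rw [lanczosResidual, dotProduct_sub, dotProduct_sub, dotProduct_smul, dotProduct_smul,
    smul_eq_mul, smul_eq_mul]
  rcases hin.eq_or_lt with rfl | hlt
  · rw [← hL.alpha_def i hi hnm, ho i i hi le_rfl hi le_rfl, if_pos rfl,
      dotProduct_comm, hpred (i - 1) i (by omega) hi le_rfl]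
    ring
  · rw [hH.dotProduct_mulVec_comm, mulVec_eq_add_lanczosResidual H α β v i,
      hL.lanczosResidual_eq hi (by omega), dotProduct_comm, add_dotProduct, add_dotProduct,
      smul_dotProduct, smul_dotProduct, smul_dotProduct,
      hpred i n hlt (by omega) le_rfl, hpred (i - 1) n (by omega) (by omega) le_rfl,
      ho (i + 1) n (by omega) hlt (by omega) le_rfl,
      ho i (n - 1) hi (by omega) (by omega) (by omega)]
    rcases Nat.lt_or_ge (i + 1) n with h | h
    · simp [show i + 1 ≠ n by omega, show i ≠ n - 1 by omega]
    · obtain rfl : n = i + 1 := by omega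
      simp

theorem orthonormal (hL : IsLanczos H m α β v) (hH : H.IsSymm) :
    ∀ n ≤ m, ∀ i j, 1 ≤ i → i ≤ n → 1 ≤ j → j ≤ n →
      v i ⬝ᵥ v j = if i = j then 1 else 0 := by
  intro n
  induction n with
  | zero => intro _ i j hi hi0; omega
  | succ n ih =>
    intro hn i j hi hin hj hjn
    have ho := ih (by omega)
    rcases Nat.eq_zero_or_pos n with rfl | hpos
    · obtain rfl : i = 1 := by omega
      obtain rfl : j = 1 := by omega
      simpa using hL.seed_unit
    have hlast : ∀ k, 1 ≤ k → k ≤ n → v k ⬝ᵥ v (n + 1) = 0 := by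
      intro k hk hkn
      have h := hL.dotProduct_lanczosResidual hH (by omega) ho hk hkn
      rw [hL.lanczosResidual_eq hpos hn, dotProduct_smul, smul_eq_mul] at h
      exact (mul_eq_zero.mp h).resolve_left (hL.beta_ne (n + 1) (by omega) hn)
    rcases hin.eq_or_lt with rfl | hi'
    · rcases hjn.eq_or_lt with rfl | hj'
      · rw [if_pos rfl, hL.dotProduct_self_succ hpos hn]
      · rw [if_neg (by omega), dotProduct_comm, hlast j hj (by omega)]
    · rcases hjn.eq_or_lt with rfl | hj'
      · rw [if_neg (by omega), hlast i hi (by omega)]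
      · exact ho i j hi (by omega) hj (by omega)

/-- The columns of the Lanczos relation `H V = V T_m + r_m e_mᵀ`. -/
theorem mulVec_eq_sum (hL : IsLanczos H m α β v) (j : Fin m) :
    H.mulVec (v (j + 1)) = ∑ i : Fin m, lanczosTridiag m α β i j • v (i + 1) +
      if (j : ℕ) + 1 = m then lanczosResidual H α β v m else 0 := by
  obtain ⟨j, hj⟩ := j
  have hentry : ∀ i : Fin m, lanczosTridiag m α β i ⟨j, hj⟩ • v (i + 1) =
      (if (i : ℕ) = j then α (j + 1) • v (j + 1) else 0) +
      (if (i : ℕ) + 1 = j then β (j + 1) • v j else 0) +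
      (if (i : ℕ) = j + 1 then β (j + 2) • v (j + 2) else 0) := by
    rintro ⟨i, hi⟩
    simp only [lanczosTridiag, Matrix.of_apply]
    split_ifs <;> first | omega | (subst_vars; simp)
  have hsum : ∑ i : Fin m, lanczosTridiag m α β i ⟨j, hj⟩ • v (i + 1) =
      α (j + 1) • v (j + 1) + β (j + 1) • v j +
        if j + 1 < m then β (j + 2) • v (j + 2) else 0 := by
    rw [Finset.sum_congr rfl fun i _ => hentry i, Finset.sum_add_distrib,
      Finset.sum_add_distrib,
      Fin.sum_univ_eq_sum_range (fun i => if i = j then α (j + 1) • v (j + 1) else 0),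
      Fin.sum_univ_eq_sum_range (fun i => if i + 1 = j then β (j + 1) • v j else 0),
      Fin.sum_univ_eq_sum_range (fun i => if i = j + 1 then β (j + 2) • v (j + 2) else 0)]
    congr 1
    · congr 1
      · simp [hj]
      · rcases j with _ | j
        · simp [hL.v_zero]
        · simp [show j < m by omega]
    · simp
  rw [hsum, mulVec_eq_add_lanczosResidual H α β v (j + 1), Nat.add_sub_cancel]
  rcases Nat.lt_or_ge (j + 1) m with h | h
  · simp [hL.lanczosResidual_eq (Nat.succ_pos j) h, h, h.ne]
  · obtain rfl : m = j + 1 := by omega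
    simp

end IsLanczos

theorem lanczosTridiag_pow_apply_zero_of_lt {m : ℕ} (hm : 0 < m) (α β : ℕ → ℝ) (k : ℕ) :
    ∀ i : Fin m, k < i → (lanczosTridiag m α β ^ k) i ⟨0, hm⟩ = 0 := by
  induction k with
  | zero =>
    intro i hi
    rw [pow_zero, Matrix.one_apply_ne (by rintro rfl; simp at hi)]
  | succ k ih =>
    intro i hi
    rw [pow_succ', Matrix.mul_apply]
    refine Finset.sum_eq_zero fun j _ => ?_
    rcases Nat.lt_or_ge k j with h | h
    · rw [ih j h, mul_zero]
    · rw [lanczosTridiag, Matrix.of_apply, if_neg (by omega), if_neg (by omega),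
        if_neg (by omega), zero_mul]

theorem IsLanczos.pow_mulVec_seed {P : ℕ} {H : Matrix (Fin P) (Fin P) ℝ} {m : ℕ}
    {α β : ℕ → ℝ} {v : ℕ → (Fin P → ℝ)} (hL : IsLanczos H m α β v) (hm : 0 < m) (k : ℕ) :
    k ≤ m → ∃ c : ℝ, (k < m → c = 0) ∧ (H ^ k).mulVec (v 1) =
      ∑ i : Fin m, (lanczosTridiag m α β ^ k) i ⟨0, hm⟩ • v (i + 1) +
        c • lanczosResidual H α β v m := by
  induction k with
  | zero =>
    intro _
    refine ⟨0, fun _ => rfl, ?_⟩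
    simp [Matrix.one_apply]
  | succ k ih =>
    intro hk
    obtain ⟨c, hc, h⟩ := ih (by omega)
    rw [hc hk, zero_smul, add_zero] at h
    have hlast : m - 1 < m := by omega
    refine ⟨(lanczosTridiag m α β ^ k) ⟨m - 1, hlast⟩ ⟨0, hm⟩, fun hlt =>
      lanczosTridiag_pow_apply_zero_of_lt hm α β k _ (by simp; omega), ?_⟩
    rw [pow_succ', ← mulVec_mulVec, h, mulVec_sum]
    simp only [mulVec_smul, hL.mulVec_eq_sum, smul_add, Finset.sum_add_distrib]
    congr 1
    · simp only [pow_succ', Matrix.mul_apply, Finset.sum_smul, Finset.smul_sum, smul_smul]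
      rw [Finset.sum_comm]
      simp only [mul_comm]
    · rw [Finset.sum_eq_single ⟨m - 1, hlast⟩]
      · rw [if_pos (by simp; omega)]
      · intro j _ hj
        rw [if_neg, smul_zero]
        intro hjm
        exact hj (Fin.ext (by simp; omega))
      · simp

/-- Moment matching of the Lanczos approximation: if `m` steps of the Lanczos
recurrence applied to a real symmetric `P×P` matrix `H` with unit seed `v 1`
(with `β 2, …, β m` all nonzero) produce the tridiagonal matrix `T_m`, then for every
`0 ≤ k ≤ m`, `v_1ᵀ H^k v_1 = e_1ᵀ (T_m)^k e_1`, where `e_1` is the first standard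
basis vector of `ℝ^m`. -/
theorem lanczos_matches_moments
    {P : ℕ} (H : Matrix (Fin P) (Fin P) ℝ) (hH : H.IsSymm)
    (m : ℕ) (hm : 0 < m) (α β : ℕ → ℝ) (v : ℕ → (Fin P → ℝ))
    (hL : IsLanczos H m α β v) :
    ∀ k : ℕ, k ≤ m →
      v 1 ⬝ᵥ (H ^ k).mulVec (v 1) =
        ((lanczosTridiag m α β) ^ k) ⟨0, hm⟩ ⟨0, hm⟩ := by
  intro k hk
  obtain ⟨c, -, h⟩ := hL.pow_mulVec_seed hm k hk
  have ho := hL.orthonormal hH m le_rfl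
  rw [h, dotProduct_add, dotProduct_smul,
    hL.dotProduct_lanczosResidual hH le_rfl ho le_rfl hm, smul_zero, add_zero,
    dotProduct_sum, Finset.sum_eq_single ⟨0, hm⟩]
  · simp [hL.seed_unit]
  · intro i _ hi
    have hi0 : (i : ℕ) ≠ 0 := fun h0 => hi (Fin.ext h0)
    rw [dotProduct_smul, ho 1 (i + 1) le_rfl hm (by omega) (by omega), if_neg (by omega),
      smul_zero]
  · simp
end

section
/- (Kaniel–Paige convergence bound for Lanczos.) Let H be a real symmetric n×n matrix with eigenvalues λ_1 ≥ λ_2 ≥ ⋯ ≥ λ_n satisfying λ_1 > λ_2 > λ_n, and let z_1 be a unit eigenvector for λ_1. Let v be a unit vector with c := ⟨v, z_1⟩ ≠ 0, and for m ≥ 1 let θ_1 := max{⟨w, Hw⟩/⟨w, w⟩ : w ∈ K_m(H, v), w ≠ 0} be the largest Ritz value over the order-m Krylov subspace. Then λ_1 ≥ θ_1 ≥ λ_1 − (λ_1 − λ_n) · tan²φ / (T_{m−1}(1 + 2ρ_1))², where cos φ = |c| (so tan²φ = (1 − c²)/c²), ρ_1 = (λ_1 − λ_2)/(λ_2 − λ_n),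 and T_{m−1} is the degree-(m−1) Chebyshev polynomial of the first kind. -/
open Matrix Polynomial

/-- Parseval's identity for `n` vectors of `ℝⁿ` that are orthonormal for the dot product. -/
theorem dotProduct_eq_sum_of_orthonormal {ι : Type*} [Fintype ι] [DecidableEq ι]
    {z : ι → ι → ℝ} (horth : ∀ i j, z i ⬝ᵥ z j = if i = j then (1 : ℝ) else 0) (x y : ι → ℝ) :
    x ⬝ᵥ y = ∑ i, (z i ⬝ᵥ x) * (z i ⬝ᵥ y) := by
  have hQ : Matrix.of z * (Matrix.of z)ᵀ = 1 := by
    ext i j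
    rw [Matrix.one_apply]
    exact horth i j
  calc x ⬝ᵥ y = x ⬝ᵥ ((Matrix.of z)ᵀ * Matrix.of z) *ᵥ y := by
        rw [mul_eq_one_comm.mp hQ, one_mulVec]
    _ = (Matrix.of z *ᵥ x) ⬝ᵥ (Matrix.of z *ᵥ y) := by
        rw [← mulVec_mulVec, dotProduct_mulVec, vecMul_transpose]

/-- A left eigenvector of `A` is a left eigenvector of every polynomial in `A`. -/
theorem vecMul_aeval_of_vecMul_eq_smul {R ι : Type*} [CommRing R] [Fintype ι] [DecidableEq ι]
    {A : Matrix ι ι R} {x : ι → R} {μ : R} (h : x ᵥ* A = μ • x) (p : R[X]) :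
    x ᵥ* aeval A p = p.eval μ • x := by
  induction p using Polynomial.induction_on' with
  | add p q hp hq => rw [map_add, vecMul_add, hp, hq, eval_add, add_smul]
  | monomial k a =>
    have hpow : x ᵥ* A ^ k = μ ^ k • x := by
      induction k with
      | zero => simp
      | succ k ih => rw [pow_succ, ← vecMul_vecMul, ih, smul_vecMul, h, smul_smul, pow_succ]
    rw [aeval_monomial, eval_monomial, ← Algebra.smul_def, vecMul_smul, hpow, smul_smul]

/-- A polynomial in `A` of degree less than `m`, applied to `v`, lies in the order-`m` Krylov
subspace. -/
theorem aeval_mulVec_mem_span_krylov {R ι : Type*} [CommRing R] [Fintype ι] [DecidableEq ι]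
    (A : Matrix ι ι R) (v : ι → R) {m : ℕ} {p : R[X]} (hp : p.natDegree < m) :
    aeval A p *ᵥ v ∈
      Submodule.span R (Set.range fun j : Fin m => (A ^ (j : ℕ)) *ᵥ v) := by
  rw [aeval_eq_sum_range' hp, sum_mulVec]
  refine Submodule.sum_mem _ fun k hk => ?_
  rw [smul_mulVec]
  exact Submodule.smul_mem _ _ (Submodule.subset_span ⟨⟨k, Finset.mem_range.mp hk⟩, rfl⟩)

/-- If a polynomial `p` is bounded by `1` in absolute value at the eigenvalues other than
`lam i₀`, then the Rayleigh quotient of `p(H) v` is within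
`(lam i₀ - l) * tan²φ / p(lam i₀)²` of `lam i₀`, for any lower bound `l` of the eigenvalues. -/
theorem sub_le_rayleigh_aeval_mulVec {ι : Type*} [Fintype ι] [DecidableEq ι]
    {H : Matrix ι ι ℝ} {lam : ι → ℝ} {z : ι → ι → ℝ}
    (heig : ∀ i, z i ᵥ* H = lam i • z i)
    (horth : ∀ i j, z i ⬝ᵥ z j = if i = j then (1 : ℝ) else 0)
    {i₀ : ι} {l : ℝ} (hl : ∀ i, l ≤ lam i)
    {v : ι → ℝ} (hv : v ⬝ᵥ v = 1) (hc : z i₀ ⬝ᵥ v ≠ 0)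
    {p : ℝ[X]} (hp₀ : p.eval (lam i₀) ≠ 0) (hp : ∀ i, i ≠ i₀ → |p.eval (lam i)| ≤ 1) :
    aeval H p *ᵥ v ≠ 0 ∧
      lam i₀ - (lam i₀ - l) * ((1 - (z i₀ ⬝ᵥ v) ^ 2) / (z i₀ ⬝ᵥ v) ^ 2) /
          p.eval (lam i₀) ^ 2 ≤
        ((aeval H p *ᵥ v) ⬝ᵥ H *ᵥ (aeval H p *ᵥ v)) /
          ((aeval H p *ᵥ v) ⬝ᵥ (aeval H p *ᵥ v)) := by
  set w := aeval H p *ᵥ v with hw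
  set a : ι → ℝ := fun i => z i ⬝ᵥ v with ha
  have hzw (i : ι) : z i ⬝ᵥ w = p.eval (lam i) * a i := by
    rw [hw, dotProduct_mulVec, vecMul_aeval_of_vecMul_eq_smul (heig i), smul_dotProduct,
      smul_eq_mul]
  have hww : w ⬝ᵥ w = ∑ i, (p.eval (lam i) * a i) ^ 2 := by
    rw [dotProduct_eq_sum_of_orthonormal horth]
    simp_rw [hzw, sq]
  have hwHw : w ⬝ᵥ H *ᵥ w = ∑ i, lam i * (p.eval (lam i) * a i) ^ 2 := by
    rw [dotProduct_eq_sum_of_orthonormal horth]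
    refine Finset.sum_congr rfl fun i _ => ?_
    rw [dotProduct_mulVec _ H w, heig, smul_dotProduct, hzw, smul_eq_mul]
    ring
  have hsum : ∑ i ∈ Finset.univ.erase i₀, a i ^ 2 = 1 - a i₀ ^ 2 := by
    rw [Finset.sum_erase_eq_sub (Finset.mem_univ i₀), ← hv,
      dotProduct_eq_sum_of_orthonormal horth v v]
    simp_rw [ha, sq]
  have hlow : p.eval (lam i₀) ^ 2 * a i₀ ^ 2 ≤ w ⬝ᵥ w := by
    rw [hww, ← mul_pow]
    exact Finset.single_le_sum (f := fun i => (p.eval (lam i) * a i) ^ 2)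
      (fun i _ => sq_nonneg _) (Finset.mem_univ i₀)
  have hpos : 0 < p.eval (lam i₀) ^ 2 * a i₀ ^ 2 := by
    have : a i₀ ≠ 0 := hc
    positivity
  have hgap : lam i₀ * (w ⬝ᵥ w) - w ⬝ᵥ H *ᵥ w ≤ (lam i₀ - l) * (1 - a i₀ ^ 2) := by
    rw [hww, hwHw, Finset.mul_sum, ← Finset.sum_sub_distrib, ← hsum, Finset.mul_sum,
      ← Finset.add_sum_erase _ _ (Finset.mem_univ i₀), sub_self, zero_add]
    refine Finset.sum_le_sum fun i hi => ?_
    have h1 : p.eval (lam i) ^ 2 ≤ 1 := (sq_le_one_iff_abs_le_one _).mpr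
      (hp i (Finset.ne_of_mem_erase hi))
    have h2 : (p.eval (lam i) * a i) ^ 2 ≤ a i ^ 2 := by
      rw [mul_pow]
      exact mul_le_of_le_one_left (sq_nonneg _) h1
    rw [← sub_mul]
    exact mul_le_mul (by linarith [hl i]) h2 (sq_nonneg _) (by linarith [hl i₀])
  have hwpos : 0 < w ⬝ᵥ w := hpos.trans_le hlow
  have hnonneg : 0 ≤ (lam i₀ - l) * (1 - a i₀ ^ 2) :=
    mul_nonneg (by linarith [hl i₀]) (hsum ▸ Finset.sum_nonneg fun i _ => sq_nonneg _)
  refine ⟨fun h => by simp [h] at hwpos, ?_⟩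
  have hdiv : lam i₀ - (w ⬝ᵥ H *ᵥ w) / (w ⬝ᵥ w) ≤
      (lam i₀ - l) * (1 - a i₀ ^ 2) / (p.eval (lam i₀) ^ 2 * a i₀ ^ 2) :=
    calc lam i₀ - (w ⬝ᵥ H *ᵥ w) / (w ⬝ᵥ w)
        = (lam i₀ * (w ⬝ᵥ w) - w ⬝ᵥ H *ᵥ w) / (w ⬝ᵥ w) := by field_simp
      _ ≤ (lam i₀ - l) * (1 - a i₀ ^ 2) / (w ⬝ᵥ w) := by gcongr
      _ ≤ _ := by gcongr
  have heq : (lam i₀ - l) * ((1 - a i₀ ^ 2) / a i₀ ^ 2) / p.eval (lam i₀) ^ 2 =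
      (lam i₀ - l) * (1 - a i₀ ^ 2) / (p.eval (lam i₀) ^ 2 * a i₀ ^ 2) := by
    rw [← mul_div_assoc, div_div, mul_comm (a i₀ ^ 2)]
  change lam i₀ - (lam i₀ - l) * ((1 - a i₀ ^ 2) / a i₀ ^ 2) / p.eval (lam i₀) ^ 2 ≤ _
  linarith

/-- The Rayleigh quotient is at most the top eigenvalue. -/
theorem rayleigh_le_of_eigenbasis {ι : Type*} [Fintype ι] [DecidableEq ι]
    {H : Matrix ι ι ℝ} {lam : ι → ℝ} {z : ι → ι → ℝ}
    (heig : ∀ i, z i ᵥ* H = lam i • z i)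
    (horth : ∀ i j, z i ⬝ᵥ z j = if i = j then (1 : ℝ) else 0)
    {M : ℝ} (hM : ∀ i, lam i ≤ M) {w : ι → ℝ} (hw : w ≠ 0) :
    (w ⬝ᵥ H *ᵥ w) / (w ⬝ᵥ w) ≤ M := by
  have hwpos : 0 < w ⬝ᵥ w :=
    lt_of_le_of_ne (Finset.sum_nonneg fun i _ => mul_self_nonneg _)
      (Ne.symm (mt dotProduct_self_eq_zero.mp hw))
  rw [div_le_iff₀ hwpos, dotProduct_eq_sum_of_orthonormal horth w (H *ᵥ w),
    dotProduct_eq_sum_of_orthonormal horth w w, Finset.mul_sum]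
  refine Finset.sum_le_sum fun i _ => ?_
  rw [dotProduct_mulVec, heig, smul_dotProduct, smul_eq_mul, mul_left_comm]
  exact mul_le_mul_of_nonneg_right (hM i) (mul_self_nonneg _)

/-- Kaniel–Paige convergence bound for Lanczos.  Let `H` be real symmetric `n×n` with
eigenvalues `λ_1 ≥ ⋯ ≥ λ_n` (given with an orthonormal eigenbasis `z`), satisfying
`λ_1 > λ_2 > λ_n`.  Let `v` be a unit seed with `c = ⟨v, z_1⟩ ≠ 0`, and let `θ_1` be
the largest Rayleigh quotient over the order-`m` Krylov subspace `K_m(H, v)` (the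
largest Ritz value after `m` Lanczos steps).  Then
`λ_1 ≥ θ_1 ≥ λ_1 − (λ_1 − λ_n)·tan²φ / T_{m−1}(1 + 2ρ_1)²`, where
`tan²φ = (1 − c²)/c²`, `ρ_1 = (λ_1 − λ_2)/(λ_2 − λ_n)` and `T_{m−1}` is the
Chebyshev polynomial of the first kind of degree `m − 1`. -/
theorem kaniel_paige_lanczos_bound
    {n : ℕ} (hn : 1 < n) (H : Matrix (Fin n) (Fin n) ℝ) (hH : H.IsSymm)
    (lam : Fin n → ℝ) (z : Fin n → (Fin n → ℝ))
    (heig : ∀ i, H.mulVec (z i) = lam i • z i)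
    (horth : ∀ i j, z i ⬝ᵥ z j = if i = j then (1 : ℝ) else 0)
    (hmono : ∀ i j : Fin n, i ≤ j → lam j ≤ lam i)
    (h12 : lam ⟨1, hn⟩ < lam ⟨0, by omega⟩)
    (h2n : lam ⟨n - 1, by omega⟩ < lam ⟨1, hn⟩)
    (v : Fin n → ℝ) (hv : v ⬝ᵥ v = 1)
    (c : ℝ) (hc : c = v ⬝ᵥ z ⟨0, by omega⟩) (hc0 : c ≠ 0)
    (m : ℕ) (hm : 1 ≤ m)
    (θ₁ : ℝ)
    (hθ : IsGreatest
      {r : ℝ | ∃ w : Fin n → ℝ,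
        w ∈ Submodule.span ℝ (Set.range fun j : Fin m => (H ^ (j : ℕ)).mulVec v) ∧
        w ≠ 0 ∧ r = (w ⬝ᵥ H.mulVec w) / (w ⬝ᵥ w)} θ₁)
    (ρ₁ : ℝ)
    (hρ : ρ₁ = (lam ⟨0, by omega⟩ - lam ⟨1, hn⟩) / (lam ⟨1, hn⟩ - lam ⟨n - 1, by omega⟩)) :
    θ₁ ≤ lam ⟨0, by omega⟩ ∧
      lam ⟨0, by omega⟩ -
          (lam ⟨0, by omega⟩ - lam ⟨n - 1, by omega⟩) * ((1 - c ^ 2) / c ^ 2) /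
            ((Polynomial.Chebyshev.T ℝ ((m : ℤ) - 1)).eval (1 + 2 * ρ₁)) ^ 2 ≤ θ₁ := by
  have heig' (i : Fin n) : z i ᵥ* H = lam i • z i := by
    rw [← heig i, ← mulVec_transpose, hH.eq]
  have htop (i : Fin n) : lam i ≤ lam ⟨0, by omega⟩ := hmono _ _ (Fin.mk_le_of_le_val (by omega))
  have hbot (i : Fin n) : lam ⟨n - 1, by omega⟩ ≤ lam i := hmono _ _ (Fin.le_def.mpr (by grind))
  have hsnd (i : Fin n) (hi : i ≠ ⟨0, by omega⟩) : lam i ≤ lam ⟨1, hn⟩ :=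
    hmono _ _ (Fin.le_def.mpr (by
      have : (i : ℕ) ≠ 0 := fun h => hi (Fin.ext h)
      change 1 ≤ (i : ℕ)
      omega))
  obtain ⟨⟨w, -, hw0, hθw⟩, hub⟩ := hθ
  refine ⟨hθw ▸ rayleigh_le_of_eigenbasis heig' horth htop hw0, ?_⟩
  have hd : 0 < lam ⟨1, hn⟩ - lam ⟨n - 1, by omega⟩ := sub_pos.mpr h2n
  set d := lam ⟨1, hn⟩ - lam ⟨n - 1, by omega⟩ with hd_def
  set p : ℝ[X] := (Chebyshev.T ℝ ((m : ℤ) - 1)).comp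
    (C (2 / d) * X + C (-(lam ⟨1, hn⟩ + lam ⟨n - 1, by omega⟩) / d)) with hp_def
  have hpeval (x : ℝ) : p.eval x = (Chebyshev.T ℝ ((m : ℤ) - 1)).eval
      ((2 * x - (lam ⟨1, hn⟩ + lam ⟨n - 1, by omega⟩)) / d) := by
    rw [hp_def, eval_comp]
    congr 1
    simp only [eval_add, eval_mul, eval_C, eval_X]
    ring
  have hptop : p.eval (lam ⟨0, by omega⟩) =
      (Chebyshev.T ℝ ((m : ℤ) - 1)).eval (1 + 2 * ρ₁) := by
    rw [hpeval, hρ]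
    congr 1
    field_simp
    rw [hd_def]
    ring
  have hρ0 : 0 ≤ ρ₁ := hρ ▸ div_nonneg (sub_nonneg.mpr h12.le) hd.le
  have hp0 : p.eval (lam ⟨0, by omega⟩) ≠ 0 := by
    rw [hptop]
    have := Chebyshev.one_le_eval_T_real ((m : ℤ) - 1) (x := 1 + 2 * ρ₁) (by linarith)
    linarith
  have hp1 (i : Fin n) (hi : i ≠ ⟨0, by omega⟩) : |p.eval (lam i)| ≤ 1 := by
    rw [hpeval]
    refine Chebyshev.abs_eval_T_real_le_one _ ?_
    rw [abs_le, le_div_iff₀ hd, div_le_iff₀ hd]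
    constructor <;> linarith [hsnd i hi, hbot i]
  have hdeg : p.natDegree < m := by
    have h1 := natDegree_comp_le (p := Chebyshev.T ℝ ((m : ℤ) - 1))
      (q := C (2 / d) * X + C (-(lam ⟨1, hn⟩ + lam ⟨n - 1, by omega⟩) / d))
    have h2 := Nat.mul_le_mul_left (Chebyshev.T ℝ ((m : ℤ) - 1)).natDegree
      (natDegree_linear_le (a := 2 / d)
        (b := -(lam ⟨1, hn⟩ + lam ⟨n - 1, by omega⟩) / d))
    rw [Chebyshev.natDegree_T] at h1 h2
    rw [hp_def]
    omega
  rw [dotProduct_comm] at hc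
  obtain ⟨hne, hle⟩ := sub_le_rayleigh_aeval_mulVec heig' horth hbot hv (hc ▸ hc0) hp0 hp1
  rw [← hc, hptop] at hle
  exact hle.trans (hub ⟨_, aeval_mulVec_mem_span_krylov H v hdeg, hne, rfl⟩)
end
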